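/- Fix a positive integer n. For each N ≥ n let A = A_N = 2·√((log N)/n) and define the truncated likelihood ratio L'_π = (1/|S|) · Σ_{S ∈ S} exp(A·X_S − A²n²/2) · 1{ X_S ≤ A·n² } (where S and the underlying Gaussian matrix are those of size N). Then E₀(L'_π) = 1/2 for every N, and lim_{N→∞} Var₀(L'_π) = 0. -/

import Mathlib

open MeasureTheory ProbabilityTheory Real Filter Topology

noncomputable section

/-- Law of the N×N Gaussian observation matrix with mean matrix θ and unit variances. -/
def PTheta (N : ℕ) (θ : Fin N → Fin N → ℝ) : Measure (Fin N → Fin N → ℝ) :=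
  Measure.pi fun i => Measure.pi fun j => gaussianReal (θ i j) 1

/-- Parameter space Θ(A, n, N). -/
def ThetaSet (A : ℝ) (n N : ℕ) : Set (Fin N → Fin N → ℝ) :=
  {θ | ∃ R C : Finset (Fin N), R.card = n ∧ C.card = n ∧
    (∀ i j, i ∈ R → j ∈ C → A ≤ θ i j) ∧
    (∀ i j, ¬(i ∈ R ∧ j ∈ C) → θ i j = 0)}

/-- Risk of the test with rejection region `T`: type-I error plus worst-case type-II error. -/
def testRisk (n N : ℕ) (A : ℝ) (T : Set (Fin N → Fin N → ℝ)) : ℝ :=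
  (PTheta N 0 T).toReal + ⨆ θ : ThetaSet A n N, (PTheta N θ.1 Tᶜ).toReal

/-- Minimax risk over all (measurable) tests. -/
def minimaxRisk (n N : ℕ) (A : ℝ) : ℝ :=
  ⨅ T : {T : Set (Fin N → Fin N → ℝ) // MeasurableSet T}, testRisk n N A T.1

/-- The family S of n×n product subsets R×C of [N]×[N]. -/
def SIdx (n N : ℕ) : Type :=
  {p : Finset (Fin N) × Finset (Fin N) // p.1.card = n ∧ p.2.card = n}

instance (n N : ℕ) : Fintype (SIdx n N) := by unfold SIdx; infer_instance

/-- The sum X_S of the entries of x over the product set S = R×C. -/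
def XS {n N : ℕ} (S : SIdx n N) (x : Fin N → Fin N → ℝ) : ℝ :=
  ∑ i ∈ S.1.1, ∑ j ∈ S.1.2, x i j

/-- The likelihood ratio truncated at level c:
`L'_π = (1/|S|) Σ_S exp(A X_S − A²n²/2) 1{X_S ≤ c}`. -/
def LpiTrunc (n N : ℕ) (A c : ℝ) (x : Fin N → Fin N → ℝ) : ℝ :=
  (((N.choose n : ℝ)) ^ 2)⁻¹ * ∑ S : SIdx n N,
    {y | XS S y ≤ c}.indicator (fun y => Real.exp (A * XS S y - A ^ 2 * (n : ℝ) ^ 2 / 2)) x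

lemma hasLaw_sum_pi {ι : Type*} [Fintype ι] {Ω : ι → Type*} [∀ i, MeasurableSpace (Ω i)]
    (μ : ∀ i, Measure (Ω i)) [∀ i, IsProbabilityMeasure (μ i)] (f : ∀ i, Ω i → ℝ)
    (hf : ∀ i, Measurable (f i))
    (v : ι → NNReal) (h : ∀ i, (μ i).map (f i) = gaussianReal 0 (v i)) :
    (Measure.pi μ).map (fun x => ∑ i, f i (x i)) = gaussianReal 0 (∑ i, v i) := by
  have hmap : ∀ i, (Measure.pi μ).map (fun x => f i (x i)) = gaussianReal 0 (v i) := by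
    intro i
    rw [← h i, ← (measurePreserving_eval μ i).map_eq, Measure.map_map (hf i) (measurable_pi_apply i)]
    rfl
  have hind : iIndepFun (fun i x => f i (x i)) (Measure.pi μ) :=
    iIndepFun_pi (fun i => (hf i).aemeasurable)
  have key : ∀ s : Finset ι, (Measure.pi μ).map (∑ i ∈ s, fun x => f i (x i))
      = gaussianReal 0 (∑ i ∈ s, v i) := by
    classical
    intro s
    induction s using Finset.induction_on with
    | empty =>
      simp only [Finset.sum_empty, gaussianReal_zero_var]
      rw [show (0 : (∀ i, Ω i) → ℝ) = fun _ => 0 from rfl, Measure.map_const]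
      simp
    | insert a s ha ih =>
      rw [Finset.sum_insert ha, Finset.sum_insert ha]
      have := gaussianReal_add_gaussianReal_of_indepFun
        (hind.indepFun_finsetSum_of_notMem (fun i => (hf i).comp (measurable_pi_apply i)) ha).symm
        (hmap a) ih
      simpa using this
  rw [← key Finset.univ]
  congr 1
  ext x
  simp

instance instPThetaProb (N : ℕ) (θ) : IsProbabilityMeasure (PTheta N θ) := by
  unfold PTheta; infer_instance

lemma law_linear (N : ℕ) (w : Fin N → Fin N → ℝ) :
    (PTheta N 0).map (fun x => ∑ i, ∑ j, w i j * x i j)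
      = gaussianReal 0 (∑ i, ∑ j, ((w i j) ^ 2).toNNReal) := by
  unfold PTheta
  refine hasLaw_sum_pi _ (fun i (y : Fin N → ℝ) => ∑ j, w i j * y j) (fun i => by fun_prop) _ (fun i => ?_)
  refine hasLaw_sum_pi _ (fun j y => w i j * y) (fun i => by fun_prop) _ (fun j => ?_)
  rw [show ((0 : Fin N → Fin N → ℝ) i j) = 0 from rfl, gaussianReal_map_const_mul]
  simp only [mul_zero, mul_one]
  congr 1
  ext
  simp [Real.coe_toNNReal _ (sq_nonneg (w i j))]

instance instPThetaGauss (N : ℕ) : IsGaussian (PTheta N 0) := by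
  have h1 : ∀ i : Fin N, HasGaussianLaw (fun x : Fin N → ℝ => x)
      (Measure.pi fun j => gaussianReal ((0 : Fin N → Fin N → ℝ) i j) 1) := by
    intro i
    refine iIndepFun.hasGaussianLaw (X := fun (j : Fin N) (x : Fin N → ℝ) => x j) (fun j => ?_) (iIndepFun_pi (X := fun j y => y) (fun j => aemeasurable_id))
    constructor
    have := (measurePreserving_eval (fun j => gaussianReal ((0 : Fin N → Fin N → ℝ) i j) 1) j).map_eq
    change Measure.map (fun x : Fin N → ℝ => x j) _ = _ at this
    rw [this]; infer_instance
  have h2 : HasGaussianLaw (fun x : Fin N → Fin N → ℝ => x) (PTheta N 0) := by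
    unfold PTheta
    refine iIndepFun.hasGaussianLaw (X := fun (j : Fin N) (x : Fin N → Fin N → ℝ) => x j) (fun j => ?_) (iIndepFun_pi (X := fun j y => y) (fun j => aemeasurable_id))
    constructor
    have := (measurePreserving_eval (fun i => Measure.pi fun j => gaussianReal ((0 : Fin N → Fin N → ℝ) i j) 1) j).map_eq
    change Measure.map (fun x : Fin N → Fin N → ℝ => x j) _ = _ at this
    rw [this]
    simpa using (h1 j).isGaussian_map
  simpa using h2.isGaussian_map

def ind {n N : ℕ} (S : SIdx n N) (i j : Fin N) : ℝ := if i ∈ S.1.1 ∧ j ∈ S.1.2 then 1 else 0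

lemma XS_eq {n N : ℕ} (S : SIdx n N) (x : Fin N → Fin N → ℝ) :
    XS S x = ∑ i, ∑ j, ind S i j * x i j := by
  unfold XS ind
  simp only [ite_mul, one_mul, zero_mul, ite_and]
  have h1 : ∀ i, (∑ j, if i ∈ S.1.1 then (if j ∈ S.1.2 then x i j else 0) else 0)
      = if i ∈ S.1.1 then ∑ j ∈ S.1.2, x i j else 0 := by
    intro i
    split_ifs <;> simp
  simp_rw [h1]
  simp

lemma sum_ind_mul {n N : ℕ} (S S' : SIdx n N) :
    ∑ i, ∑ j, ind S i j * ind S' i j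
      = ((S.1.1 ∩ S'.1.1).card : ℝ) * ((S.1.2 ∩ S'.1.2).card : ℝ) := by
  have : ∀ i j, ind S i j * ind S' i j
      = (if i ∈ S.1.1 ∩ S'.1.1 then 1 else 0) * (if j ∈ S.1.2 ∩ S'.1.2 then (1:ℝ) else 0) := by
    intro i j
    unfold ind
    simp only [Finset.mem_inter]
    split_ifs <;> simp_all
  simp_rw [this, ← Finset.sum_mul_sum, Finset.sum_ite_mem]
  simp

lemma law_XS {n N : ℕ} (S : SIdx n N) :
    (PTheta N 0).map (XS S) = gaussianReal 0 ((n : NNReal) ^ 2) := by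
  rw [show XS S = _ from funext (XS_eq S), law_linear]
  congr 1
  ext
  push_cast
  have := sum_ind_mul S S
  simp only [Finset.inter_self, S.2.1, S.2.2] at this
  simp only [Real.coe_toNNReal _ (sq_nonneg _)]
  simpa only [sq] using this

lemma law_XS_add {n N : ℕ} (S S' : SIdx n N) :
    (PTheta N 0).map (fun x => XS S x + XS S' x) = gaussianReal 0 (2 * (n : NNReal) ^ 2 +
      2 * (((S.1.1 ∩ S'.1.1).card : NNReal) * ((S.1.2 ∩ S'.1.2).card : NNReal))) := by
  have : (fun x => XS S x + XS S' x) = fun x => ∑ i, ∑ j, (ind S i j + ind S' i j) * x i j := by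
    ext x
    simp [XS_eq, add_mul, Finset.sum_add_distrib]
  rw [this, law_linear]
  congr 1
  ext
  push_cast
  have h1 := sum_ind_mul S S
  have h2 := sum_ind_mul S' S'
  have h3 := sum_ind_mul S S'
  simp only [Finset.inter_self, S.2.1, S.2.2, S'.2.1, S'.2.2] at h1 h2
  simp only [Real.coe_toNNReal _ (sq_nonneg _)]
  rw [← h3]
  have : ∀ i j, (ind S i j + ind S' i j) ^ 2 = ind S i j * ind S i j + ind S' i j * ind S' i j
    + 2 * (ind S i j * ind S' i j) := by intros; ring
  simp_rw [this, Finset.sum_add_distrib, ← Finset.mul_sum, h1, h2]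
  ring

lemma measurable_XS {n N : ℕ} (S : SIdx n N) : Measurable (XS S) := by
  unfold XS; fun_prop

lemma gauss_XS_pair {n N : ℕ} (S S' : SIdx n N) :
    HasGaussianLaw (fun x => (XS S x, XS S' x)) (PTheta N 0) := by
  let L : (Fin N → Fin N → ℝ) →L[ℝ] ℝ × ℝ :=
    { toFun := fun x => (XS S x, XS S' x)
      map_add' := by intro x y; simp [XS, Finset.sum_add_distrib]
      map_smul' := by intro x y; simp [XS, Finset.mul_sum]
      cont := by unfold XS; fun_prop }
  exact (IsGaussian.hasGaussianLaw_id (μ := PTheta N 0)).map L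

lemma indep_XS {n N : ℕ} (S S' : SIdx n N)
    (h : (S.1.1 ∩ S'.1.1).card * (S.1.2 ∩ S'.1.2).card = 0) :
    IndepFun (XS S) (XS S') (PTheta N 0) := by
  have hp := gauss_XS_pair S S'
  refine hp.indepFun_of_covariance_eq_zero ?_
  have hv : ∀ (Y : (Fin N → Fin N → ℝ) → ℝ) (v : NNReal), Measurable Y →
      (PTheta N 0).map Y = gaussianReal 0 v → variance Y (PTheta N 0) = v := by
    intro Y v hY h
    rw [← variance_id_gaussianReal (μ := 0) (v := v), ← h, variance_id_map hY.aemeasurable]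
  have e1 := hv _ _ (measurable_XS S) (law_XS S)
  have e2 := hv _ _ (measurable_XS S') (law_XS S')
  have e3 := hv _ _ ((measurable_XS S).add (measurable_XS S')) (law_XS_add S S')
  have e4 := variance_add hp.fst.memLp_two hp.snd.memLp_two
  have h' : ((S.1.1 ∩ S'.1.1).card : ℝ) * ((S.1.2 ∩ S'.1.2).card : ℝ) = 0 := by exact_mod_cast h
  change variance (XS S + XS S') _ = _ at e3
  rw [e4, e1, e2] at e3
  push_cast at e3
  rw [h'] at e3
  linarith

lemma half_gauss (v : NNReal) (hv : v ≠ 0) (m : ℝ) :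
    (gaussianReal m v).real (Set.Iic m) = 1 / 2 := by
  have := nullSingletonClass_gaussianReal (μ := m) hv
  have h1 : (gaussianReal m v).real (Set.Iic m) = (gaussianReal m v).real (Set.Ici m) := by
    have e : (gaussianReal m v).map (fun x => 2 * m - x) = gaussianReal m v := by
      rw [gaussianReal_map_const_sub]; congr 1; ring
    conv_lhs => rw [← e]
    rw [map_measureReal_apply (by fun_prop) measurableSet_Iic]
    congr 1
    ext x
    simp; constructor <;> intro h <;> linarith
  have h2 : (gaussianReal m v).real (Set.Ici m) = (gaussianReal m v).real (Set.Ioi m) := by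
    exact measureReal_congr Ioi_ae_eq_Ici.symm
  have h3 := measureReal_add_measureReal_compl (μ := gaussianReal m v) (measurableSet_Iic (a := m))
  rw [Set.compl_Iic, ← h2, ← h1] at h3
  simp at h3
  linarith

lemma int_gauss (n : ℕ) (hn : 0 < n) (A : ℝ) :
    ∫ y, (Set.Iic (A * (n:ℝ)^2)).indicator
      (fun y => Real.exp (A * y - A ^ 2 * (n:ℝ)^2 / 2)) y ∂(gaussianReal 0 ((n : NNReal)^2)) = 1/2 := by
  have hv : ((n : NNReal)^2) ≠ 0 := by positivity
  rw [integral_gaussianReal_eq_integral_smul hv, ← half_gauss _ hv (A * (n:ℝ)^2),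
    measureReal_def, gaussianReal_apply_eq_integral _ hv, ENNReal.toReal_ofReal
      (integral_nonneg (fun _ => gaussianPDFReal_nonneg _ _ _)), ← integral_indicator measurableSet_Iic]
  congr 1
  ext y
  by_cases hy : y ∈ Set.Iic (A * (n:ℝ)^2)
  · rw [Set.indicator_of_mem hy, Set.indicator_of_mem hy]
    simp only [gaussianPDFReal, smul_eq_mul]
    rw [mul_assoc, ← Real.exp_add]
    congr 2
    push_cast
    have : (n:ℝ) ≠ 0 := by positivity
    field_simp
    ring
  · rw [Set.indicator_of_notMem hy, Set.indicator_of_notMem hy]; simp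

lemma mills (v : NNReal) (hv : 1 ≤ v) (τ B : ℝ) (h : 0 < τ - B / v) :
    ∫ y, (Set.Iic B).indicator (fun y => Real.exp (τ * y)) y ∂(gaussianReal 0 v)
      ≤ Real.exp (τ * B - B ^ 2 / (2 * v)) / (τ - B / v) := by
  have hv0 : v ≠ 0 := by positivity
  have hvr : (1:ℝ) ≤ v := by exact_mod_cast hv
  rw [integral_gaussianReal_eq_integral_smul hv0]
  calc ∫ y, gaussianPDFReal 0 v y • (Set.Iic B).indicator (fun y => Real.exp (τ * y)) y
      ≤ ∫ y, (Set.Iic B).indicator (fun y => Real.exp (B^2/(2*v)) * Real.exp ((τ - B / v) * y)) y := by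
        apply integral_mono_of_nonneg
        · refine ae_of_all _ fun y => ?_
          exact mul_nonneg (gaussianPDFReal_nonneg _ _ _) (Set.indicator_nonneg (fun _ _ => by positivity) _)
        · rw [integrable_indicator_iff measurableSet_Iic]
          exact (integrableOn_exp_mul_Iic h B).const_mul _
        · refine ae_of_all _ fun y => ?_
          by_cases hy : y ∈ Set.Iic B
          · simp only [Set.indicator_of_mem hy, gaussianPDFReal, smul_eq_mul]
            rw [mul_assoc, ← Real.exp_add, ← Real.exp_add]
            have h1 : (√(2 * π * v))⁻¹ ≤ 1 := by
              apply inv_le_one_of_one_le₀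
              rw [Real.one_le_sqrt]
              nlinarith [Real.pi_gt_three]
            refine (mul_le_of_le_one_left (by positivity) h1).trans ?_
            apply Real.exp_le_exp.2
            have : B^2/(2*v) + (τ - B/v)*y - (-(y-0)^2/(2*v) + τ*y) = (y-B)^2/(2*v) := by
              field_simp; ring
            have : 0 ≤ (y-B)^2/(2*(v:ℝ)) := by positivity
            linarith
          · simp [Set.indicator_of_notMem hy]
    _ = Real.exp (B^2/(2*v)) * (Real.exp ((τ - B / v) * B) / (τ - B / v)) := by
        rw [integral_indicator measurableSet_Iic, integral_const_mul, integral_exp_mul_Iic h]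
    _ = _ := by
        rw [← mul_div_assoc, ← Real.exp_add]
        congr 2
        field_simp; ring

/-- One truncated likelihood term as a function of the block sum. -/
def phi (n : ℕ) (A : ℝ) : ℝ → ℝ :=
  (Set.Iic (A * (n:ℝ)^2)).indicator (fun y => Real.exp (A * y - A ^ 2 * (n:ℝ)^2 / 2))

lemma measurable_phi (n : ℕ) (A : ℝ) : Measurable (phi n A) :=
  Measurable.indicator (by fun_prop) measurableSet_Iic

lemma phi_nonneg (n : ℕ) (A : ℝ) (y : ℝ) : 0 ≤ phi n A y :=
  Set.indicator_nonneg (fun _ _ => by positivity) _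

lemma phi_le (n : ℕ) (A : ℝ) (hA : 0 ≤ A) (y : ℝ) : phi n A y ≤ Real.exp (A * (A * (n:ℝ)^2)) := by
  unfold phi
  refine Set.indicator_le' (f := fun y => Real.exp (A * y - A ^ 2 * (n:ℝ)^2 / 2))
    (g := fun _ => Real.exp (A * (A * (n:ℝ)^2))) (fun y hy => ?_) (fun _ _ => by positivity) y
  apply Real.exp_le_exp.2
  have : A * y ≤ A * (A * (n:ℝ)^2) := mul_le_mul_of_nonneg_left hy hA
  have : 0 ≤ A ^ 2 * (n:ℝ)^2 / 2 := by positivity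
  linarith

lemma LpiTrunc_eq (n N : ℕ) (A : ℝ) :
    LpiTrunc n N A (A * (n:ℝ)^2) = fun x => (((N.choose n : ℝ)) ^ 2)⁻¹ * ∑ S : SIdx n N, phi n A (XS S x) := by
  ext x
  rfl

lemma memLp_phi (n N : ℕ) (A : ℝ) (hA : 0 ≤ A) (S : SIdx n N) (p : ENNReal) :
    MemLp (fun x => phi n A (XS S x)) p (PTheta N 0) := by
  refine MemLp.of_bound ((measurable_phi n A).comp (measurable_XS S)).aestronglyMeasurable
    (Real.exp (A * (A * (n:ℝ)^2))) (ae_of_all _ fun x => ?_)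
  rw [Real.norm_of_nonneg (phi_nonneg _ _ _)]
  exact phi_le n A hA _

lemma int_phi (n N : ℕ) (hn : 0 < n) (A : ℝ) (S : SIdx n N) :
    ∫ x, phi n A (XS S x) ∂(PTheta N 0) = 1 / 2 := by
  rw [← int_gauss n hn A, ← law_XS S]
  exact (integral_map (measurable_XS S).aemeasurable
    (measurable_phi n A).aestronglyMeasurable).symm

lemma sum_SIdx (n N : ℕ) (g h : Finset (Fin N) → ℝ) :
    ∑ S : SIdx n N, g S.1.1 * h S.1.2
      = (∑ R ∈ Finset.powersetCard n Finset.univ, g R) * ∑ C ∈ Finset.powersetCard n Finset.univ, h C := by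
  rw [Finset.sum_mul_sum, ← Finset.sum_product']
  refine Finset.sum_bij (fun S _ => S.1) ?_ ?_ ?_ ?_
  · intro S _
    simp [Finset.mem_powersetCard, S.2.1, S.2.2]
  · intro S _ S' _ h
    exact Subtype.ext h
  · intro p hp
    simp only [Finset.mem_product, Finset.mem_powersetCard, Finset.subset_univ, true_and] at hp
    exact ⟨⟨p, hp⟩, Finset.mem_univ _, rfl⟩
  · intro S _
    rfl

lemma card_SIdx (n N : ℕ) : (Fintype.card (SIdx n N) : ℝ) = (N.choose n : ℝ) ^ 2 := by
  have := sum_SIdx n N (fun _ => 1) (fun _ => 1)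
  simp at this
  simpa [sq] using this

lemma choose_bound (N n : ℕ) (hnN : n ≤ N) (t : ℕ) (ht : t ≤ n) :
    N ^ t * (N - t).choose (n - t) ≤ n ^ t * N.choose n := by
  induction t with
  | zero => simp
  | succ t ih =>
    have ih := ih (by omega)
    obtain ⟨a, rfl⟩ : ∃ a, n = a + (t + 1) := ⟨n - (t+1), by omega⟩
    obtain ⟨b, rfl⟩ : ∃ b, N = a + b + (t + 1) := ⟨N - a - (t+1), by omega⟩
    rw [show a + b + (t+1) - (t+1) = a + b by omega, show a + (t+1) - (t+1) = a by omega]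
    rw [show a + b + (t+1) - t = a + b + 1 by omega, show a + (t+1) - t = a + 1 by omega] at ih
    have h1 := Nat.add_one_mul_choose_eq (a+b) a
    have h2 : (a + b + (t+1)) * (a + 1) ≤ (a + (t+1)) * (a + b + 1) := by nlinarith [Nat.zero_le (b*t)]
    refine Nat.le_of_mul_le_mul_right (c := a + b + 1) ?_ (by omega)
    calc (a + b + (t + 1)) ^ (t + 1) * (a + b).choose a * (a + b + 1)
        = (a + b + (t+1)) ^ t * (a+b+(t+1)) * ((a+b+1) * (a + b).choose a) := by ring
      _ = ((a + b + (t+1)) ^ t * (a+b+1).choose (a+1)) * ((a + b + (t+1)) * (a + 1)) := by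
          rw [h1]; ring
      _ ≤ ((a + (t+1)) ^ t * (a + b + (t+1)).choose (a + (t+1))) * ((a + (t+1)) * (a + b + 1)) :=
          Nat.mul_le_mul ih h2
      _ = _ := by ring

lemma card_superset (N n : ℕ) (T : Finset (Fin N)) :
    ((Finset.powersetCard n Finset.univ).filter (fun R => T ⊆ R)).card
      ≤ (N - T.card).choose (n - T.card) := by
  have h : (Finset.powersetCard (n - T.card) (Finset.univ \ T)).card = (N - T.card).choose (n - T.card) := by
    rw [Finset.card_powersetCard, Finset.card_sdiff_of_subset (Finset.subset_univ _)]
    simp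
  rw [← h]
  refine Finset.card_le_card_of_injOn (fun R => R \ T) ?_ ?_
  · intro R hR
    simp only [Finset.coe_filter, Finset.mem_powersetCard, Set.mem_ofPred_eq] at hR
    simp only [Finset.mem_coe, Finset.mem_powersetCard]
    refine ⟨Finset.sdiff_subset_sdiff (Finset.subset_univ _) le_rfl, ?_⟩
    rw [Finset.card_sdiff_of_subset hR.2, hR.1.2]
  · intro R hR R' hR' he
    simp only [Finset.coe_filter, Finset.mem_powersetCard, Set.mem_ofPred_eq] at hR hR'
    simp only at he
    rw [← Finset.sdiff_union_of_subset hR.2, he, Finset.sdiff_union_of_subset hR'.2]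

lemma sum_inter (N n : ℕ) (hnN : n ≤ N) (R : Finset (Fin N)) (hR : R.card = n) :
    ∑ R' ∈ Finset.powersetCard n Finset.univ, N ^ (R ∩ R').card ≤ (1 + n) ^ n * N.choose n := by
  have h1 : ∀ R', N ^ (R ∩ R').card ≤ ∑ T ∈ R.powerset, if T ⊆ R' then N ^ T.card else 0 := by
    intro R'
    refine le_trans ?_ (Finset.single_le_sum (f := fun T => if T ⊆ R' then N ^ T.card else 0)
      (fun _ _ => Nat.zero_le _) (Finset.mem_powerset.2 (Finset.inter_subset_left : R ∩ R' ⊆ R)))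
    simp [Finset.inter_subset_right]
  calc ∑ R' ∈ Finset.powersetCard n Finset.univ, N ^ (R ∩ R').card
      ≤ ∑ R' ∈ Finset.powersetCard n Finset.univ, ∑ T ∈ R.powerset, if T ⊆ R' then N ^ T.card else 0 :=
        Finset.sum_le_sum fun R' _ => h1 R'
    _ = ∑ T ∈ R.powerset, ∑ R' ∈ Finset.powersetCard n Finset.univ, if T ⊆ R' then N ^ T.card else 0 :=
        Finset.sum_comm
    _ ≤ ∑ T ∈ R.powerset, n ^ T.card * N.choose n := by
        refine Finset.sum_le_sum fun T hT => ?_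
        rw [← Finset.sum_filter, Finset.sum_const, smul_eq_mul, mul_comm]
        refine (Nat.mul_le_mul_left _ (card_superset N n T)).trans ?_
        exact choose_bound N n hnN _ (hR ▸ Finset.card_le_card (Finset.mem_powerset.1 hT))
    _ = (1 + n) ^ n * N.choose n := by
        rw [← Finset.sum_mul]
        congr 1
        have := Finset.sum_pow_mul_eq_add_pow (n : ℕ) 1 R
        simp only [one_pow, mul_one, hR] at this
        rw [this, add_comm]

lemma exponent_bound (n k l : ℝ) (hn : 0 < n) (hk : 0 ≤ k) (hl : 0 ≤ l) :
    4 * n * (k * l) / (n ^ 2 + k * l) ≤ k + l := by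
  have hkl : 0 ≤ k * l := by positivity
  rw [div_le_iff₀ (by positivity)]
  nlinarith [mul_nonneg (add_nonneg hk hl) (sq_nonneg (n - (k+l)/2)), mul_nonneg hn.le (sq_nonneg (k-l)), mul_nonneg hkl (add_nonneg hk hl), mul_nonneg hn.le hkl, sq_nonneg (k-l), sq_nonneg (n - (k+l)/2)]

lemma cov_bound (n N : ℕ) (hn : 0 < n) (hN : 2 ≤ N) (S S' : SIdx n N) (A : ℝ)
    (hA : A = 2 * Real.sqrt (Real.log N / n)) :
    covariance (fun x => phi n A (XS S x)) (fun x => phi n A (XS S' x)) (PTheta N 0)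
      ≤ (2 * (n:ℝ)^2 / A) * ((N:ℝ) ^ (S.1.1 ∩ S'.1.1).card * (N:ℝ) ^ (S.1.2 ∩ S'.1.2).card) := by
  have hlog : 0 < Real.log N := Real.log_pos (by exact_mod_cast hN)
  have hn0 : (0:ℝ) < n := by exact_mod_cast hn
  have hA0 : 0 < A := by rw [hA]; positivity
  have hA2 : A ^ 2 * n = 4 * Real.log N := by
    rw [hA, mul_pow, Real.sq_sqrt (by positivity)]; field_simp; norm_num
  set k := (S.1.1 ∩ S'.1.1).card with hk
  set l := (S.1.2 ∩ S'.1.2).card with hl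
  by_cases h : k * l = 0
  · have hi := (indep_XS S S' h).comp (measurable_phi n A) (measurable_phi n A)
    have := hi.covariance_eq_zero (memLp_phi n N A hA0.le S 2) (memLp_phi n N A hA0.le S' 2)
    change covariance (phi n A ∘ XS S) (phi n A ∘ XS S') _ ≤ _
    rw [this]
    positivity
  have hm : (1:ℝ) ≤ (k:ℝ) * l := by exact_mod_cast Nat.one_le_iff_ne_zero.2 h
  have hkn : (k:ℝ) ≤ n := by
    have := Finset.card_le_card (Finset.inter_subset_left : S.1.1 ∩ S'.1.1 ⊆ S.1.1)
    rw [S.2.1] at this; exact_mod_cast this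
  have hln : (l:ℝ) ≤ n := by
    have := Finset.card_le_card (Finset.inter_subset_left : S.1.2 ∩ S'.1.2 ⊆ S.1.2)
    rw [S.2.2] at this; exact_mod_cast this
  have hmn : (k:ℝ) * l ≤ n ^ 2 := by rw [sq]; gcongr
  rw [covariance_eq_sub (memLp_phi n N A hA0.le S 2) (memLp_phi n N A hA0.le S' 2),
    int_phi n N hn, int_phi n N hn]
  set v : NNReal := 2 * (n : NNReal) ^ 2 + 2 * ((k : NNReal) * (l : NNReal)) with hv
  have hvr : (v:ℝ) = 2 * ((n:ℝ)^2 + k * l) := by rw [hv]; push_cast; ring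
  have hv1 : 1 ≤ v := by
    have : (1:ℝ) ≤ v := by rw [hvr]; nlinarith
    exact_mod_cast this
  have hlaw := law_XS_add S S'
  rw [← hk, ← hl, ← hv] at hlaw
  set B := 2 * (A * (n:ℝ)^2) with hB
  have hBv : A - B / v = A * (k * l) / ((n:ℝ)^2 + k * l) := by
    rw [hB, hvr]; field_simp; ring
  have hpos : 0 < A - B / v := by rw [hBv]; positivity
  have hlow : A / (2 * (n:ℝ)^2) ≤ A - B / v := by
    rw [hBv, div_le_div_iff₀ (by positivity) (by positivity), mul_assoc]
    refine mul_le_mul_of_nonneg_left ?_ hA0.le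
    nlinarith
  have hm1 := mills v hv1 A B hpos
  rw [← hlaw, integral_map (φ := fun x => XS S x + XS S' x)
    ((measurable_XS S).add (measurable_XS S')).aemeasurable
    (Measurable.indicator (by fun_prop) measurableSet_Iic).aestronglyMeasurable] at hm1
  have hprod : ∫ x, ((fun x => phi n A (XS S x)) * (fun x => phi n A (XS S' x))) x ∂(PTheta N 0)
      ≤ Real.exp (-(A^2 * (n:ℝ)^2)) *
        ∫ x, (Set.Iic B).indicator (fun y => Real.exp (A * y)) (XS S x + XS S' x) ∂(PTheta N 0) := by
    rw [← integral_const_mul]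
    refine integral_mono_of_nonneg (ae_of_all _ fun x => ?_) ?_ (ae_of_all _ fun x => ?_)
    · exact mul_nonneg (phi_nonneg _ _ _) (phi_nonneg _ _ _)
    · refine Integrable.const_mul ?_ _
      refine Integrable.of_bound (C := Real.exp (A * B)) (Measurable.comp
        (Measurable.indicator (by fun_prop) measurableSet_Iic)
        ((measurable_XS S).add (measurable_XS S'))).aestronglyMeasurable (ae_of_all _ fun x => ?_)
      rw [Real.norm_of_nonneg (Set.indicator_nonneg (fun _ _ => by positivity) _)]
      refine Set.indicator_le' (f := fun y => Real.exp (A * y))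
        (g := fun _ => Real.exp (A * B)) (fun y hy => ?_) (fun _ _ => by positivity) _
      exact Real.exp_le_exp.2 (mul_le_mul_of_nonneg_left hy hA0.le)
    · simp only [Pi.mul_apply]
      by_cases h1 : XS S x ≤ A * (n:ℝ)^2
      · by_cases h2 : XS S' x ≤ A * (n:ℝ)^2
        · have h3 : XS S x + XS S' x ∈ Set.Iic B := by simp only [Set.mem_Iic, hB]; linarith
          unfold phi
          rw [Set.indicator_of_mem h3, Set.indicator_of_mem (Set.mem_Iic.2 h1),
            Set.indicator_of_mem (Set.mem_Iic.2 h2), ← Real.exp_add, ← Real.exp_add]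
          apply le_of_eq; congr 1; ring
        · rw [show phi n A (XS S' x) = 0 from Set.indicator_of_notMem (s := Set.Iic (A * (n:ℝ)^2)) (by simpa using h2) _, mul_zero]
          exact mul_nonneg (by positivity) (Set.indicator_nonneg (fun _ _ => by positivity) _)
      · rw [show phi n A (XS S x) = 0 from Set.indicator_of_notMem (s := Set.Iic (A * (n:ℝ)^2)) (by simpa using h1) _, zero_mul]
        exact mul_nonneg (by positivity) (Set.indicator_nonneg (fun _ _ => by positivity) _)
  have hfin : Real.exp (-(A^2 * (n:ℝ)^2)) * (Real.exp (A * B - B ^ 2 / (2 * v)) / (A - B / v))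
      ≤ (2 * (n:ℝ)^2 / A) * ((N:ℝ) ^ k * (N:ℝ) ^ l) := by
    rw [← mul_div_assoc, ← Real.exp_add]
    have hexp : -(A^2 * (n:ℝ)^2) + (A * B - B ^ 2 / (2 * v)) ≤ (k + l) * Real.log N := by
      have e : -(A^2 * (n:ℝ)^2) + (A * B - B ^ 2 / (2 * v))
          = (4 * n * (k * l) / ((n:ℝ)^2 + k * l)) * Real.log N := by
        have : Real.log N = A ^ 2 * n / 4 := by linarith
        rw [this, hB, hvr]; field_simp; ring
      rw [e]
      exact mul_le_mul_of_nonneg_right (exponent_bound n k l hn0 (by positivity) (by positivity)) hlog.le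
    have hNe : Real.exp ((k + l) * Real.log N) = (N:ℝ) ^ k * (N:ℝ) ^ l := by
      rw [← pow_add, mul_comm, Real.exp_mul, Real.exp_log (by positivity)]
      rw [← Nat.cast_add, Real.rpow_natCast]
    rw [← hNe]
    calc _ ≤ Real.exp ((k + l) * Real.log N) / (A / (2 * (n:ℝ)^2)) := by gcongr
      _ = _ := by field_simp
  have := mul_le_mul_of_nonneg_left hm1 (Real.exp_pos (-(A^2 * (n:ℝ)^2))).le
  linarith

lemma var_bound (n N : ℕ) (hn : 0 < n) (hN : 2 ≤ N) (hnN : n ≤ N) (A : ℝ)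
    (hA : A = 2 * Real.sqrt (Real.log N / n)) :
    variance (LpiTrunc n N A (A * (n:ℝ)^2)) (PTheta N 0)
      ≤ 2 * (n:ℝ)^2 / A * ((1 + n) ^ n) ^ 2 := by
  have hA0 : 0 ≤ A := by rw [hA]; positivity
  have hC : (0:ℝ) < N.choose n := by exact_mod_cast Nat.choose_pos hnN
  set D := 2 * (n:ℝ)^2 / A with hD
  have hD0 : 0 ≤ D := by positivity
  rw [LpiTrunc_eq, variance_const_mul, variance_fun_sum (fun S => memLp_phi n N A hA0 S 2)]
  have h1 : ∀ S : SIdx n N, ∑ S' : SIdx n N, covariance (fun x => phi n A (XS S x))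
      (fun x => phi n A (XS S' x)) (PTheta N 0) ≤ D * ((1 + n) ^ n * N.choose n) ^ 2 := by
    intro S
    refine (Finset.sum_le_sum fun S' _ => cov_bound n N hn hN S S' A hA).trans ?_
    rw [← Finset.mul_sum, sum_SIdx n N (fun R => (N:ℝ) ^ (S.1.1 ∩ R).card) (fun R => (N:ℝ) ^ (S.1.2 ∩ R).card)]
    have a1 : ∑ R ∈ Finset.powersetCard n Finset.univ, (N:ℝ) ^ (S.1.1 ∩ R).card ≤ (1 + n) ^ n * N.choose n := by
      exact_mod_cast sum_inter N n hnN _ S.2.1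
    have a2 : ∑ R ∈ Finset.powersetCard n Finset.univ, (N:ℝ) ^ (S.1.2 ∩ R).card ≤ (1 + n) ^ n * N.choose n := by
      exact_mod_cast sum_inter N n hnN _ S.2.2
    refine mul_le_mul_of_nonneg_left ?_ hD0
    rw [sq ((1 + (n:ℝ)) ^ n * _)]
    gcongr
  refine (mul_le_mul_of_nonneg_left (Finset.sum_le_sum fun S _ => h1 S) (by positivity)).trans ?_
  rw [Finset.sum_const, Finset.card_univ, nsmul_eq_mul, card_SIdx]
  apply le_of_eq
  field_simp

/-- **Truncated likelihood ratio in the fixed-size critical regime.**  Fix a positive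
integer n.  For N ≥ n, let `A_N = 2√(log N / n)` and truncate at `A_N n²`.  Then
`E₀(L'_π) = 1/2` for every such N, and `Var₀(L'_π) → 0` as N → ∞. -/
theorem truncated_likelihood_critical (n : ℕ) (hn : 0 < n) :
    (∀ N : ℕ, n ≤ N →
        (∫ x, LpiTrunc n N (2 * Real.sqrt (Real.log N / n))
            (2 * Real.sqrt (Real.log N / n) * (n : ℝ) ^ 2) x ∂(PTheta N 0)) = 1 / 2) ∧
    Filter.Tendsto (fun N : ℕ =>
        variance (LpiTrunc n N (2 * Real.sqrt (Real.log N / n))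
          (2 * Real.sqrt (Real.log N / n) * (n : ℝ) ^ 2)) (PTheta N 0))
      Filter.atTop (nhds 0) := by
  constructor
  · intro N hN
    have hC : (0:ℝ) < N.choose n := by exact_mod_cast Nat.choose_pos hN
    set A := 2 * Real.sqrt (Real.log N / n) with hA
    have hA0 : 0 ≤ A := by positivity
    rw [LpiTrunc_eq, integral_const_mul, integral_finsetSum _
      (fun S _ => (memLp_phi n N A hA0 S 1).integrable le_rfl)]
    simp_rw [int_phi n N hn]
    rw [Finset.sum_const, Finset.card_univ, nsmul_eq_mul, card_SIdx]
    field_simp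
  · have hlim : Tendsto (fun N : ℕ => 2 * (n:ℝ)^2 / (2 * Real.sqrt (Real.log N / n))
        * ((1 + n) ^ n) ^ 2) atTop (nhds 0) := by
      have h1 : Tendsto (fun N : ℕ => 2 * Real.sqrt (Real.log N / n)) atTop atTop := by
        refine Tendsto.const_mul_atTop (by norm_num) ?_
        refine Real.tendsto_sqrt_atTop.comp ?_
        refine Tendsto.atTop_div_const (by exact_mod_cast hn) ?_
        exact Real.tendsto_log_atTop.comp tendsto_natCast_atTop_atTop
      simpa using (h1.const_div_atTop (2 * (n:ℝ)^2)).mul_const (((1 + n : ℝ) ^ n) ^ 2)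
    refine squeeze_zero' (Eventually.of_forall fun N => variance_nonneg _ _) ?_ hlim
    filter_upwards [eventually_ge_atTop 2, eventually_ge_atTop n] with N h2 hnN
    exact var_bound n N hn h2 hnN _ rfl

end
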